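/- If 0 < h < 1/(27 r), then T_h admits a unique global minimizer over [0, ∞), and this global minimizer lies in the half-open interval (0, (s 0)²/2]. -/

import Mathlib

/-- The PRO function `T_h(α) = f₁(α) + h·f₂(α)` for Tikhonov regularization. -/
noncomputable def proT (r : ℕ) (hr : 0 < r) (s : Fin r → ℝ) (h : ℝ) (α : ℝ) : ℝ :=
  α ^ 2 / (α + (s ⟨0, hr⟩) ^ 2) ^ 2 + h * ∑ i, (s i) ^ 4 / (α + (s i) ^ 2) ^ 2

/-- The factor `g` of the derivative `T_h' = 2 / (α + s₁²)³ · g` which carries its sign. -/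
noncomputable def proTSlope (r : ℕ) (hr : 0 < r) (s : Fin r → ℝ) (h : ℝ) (α : ℝ) : ℝ :=
  α * (s ⟨0, hr⟩) ^ 2 -
    h * ∑ i, (s i) ^ 4 * ((α + (s ⟨0, hr⟩) ^ 2) / (α + (s i) ^ 2)) ^ 3

section

variable {r : ℕ} {hr : 0 < r} {s : Fin r → ℝ} {h : ℝ}

theorem hasDerivAt_proT (hpos : ∀ i, 0 < s i) {α : ℝ} (hα : 0 ≤ α) :
    HasDerivAt (proT r hr s h)
      (2 / (α + (s ⟨0, hr⟩) ^ 2) ^ 3 * proTSlope r hr s h α) α := by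
  have hne : ∀ i, α + (s i) ^ 2 ≠ 0 := fun i => by have := hpos i; positivity
  have hden : ∀ i, HasDerivAt (fun x : ℝ => (x + (s i) ^ 2) ^ 2) (2 * (α + (s i) ^ 2)) α :=
    fun i => by simpa using ((hasDerivAt_id' α).add_const ((s i) ^ 2)).fun_pow 2
  have hnum : HasDerivAt (fun x : ℝ => x ^ 2) (2 * α) α := by simpa using hasDerivAt_pow 2 α
  have hsum := HasDerivAt.fun_sum (u := Finset.univ) fun i _ =>
    (hasDerivAt_const α ((s i) ^ 4)).fun_div (hden i) (pow_ne_zero 2 (hne i))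
  refine ((hnum.fun_div (hden ⟨0, hr⟩) (pow_ne_zero 2 (hne _))).fun_add
    (hsum.const_mul h)).congr_deriv ?_
  have h0 := hne ⟨0, hr⟩
  rw [proTSlope, mul_sub, sub_eq_add_neg]
  congr 1
  · field_simp
    ring
  · rw [mul_left_comm, ← mul_neg]
    congr 1
    rw [Finset.mul_sum, ← Finset.sum_neg_distrib]
    refine Finset.sum_congr rfl fun i _ => ?_
    have hi := hne i
    field_simp
    ring

theorem continuousOn_proTSlope (hpos : ∀ i, 0 < s i) :
    ContinuousOn (proTSlope r hr s h) (Set.Ici 0) := by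
  unfold proTSlope
  refine ContinuousOn.sub (by fun_prop) (continuousOn_const.mul
    (continuousOn_finsetSum _ fun i _ => continuousOn_const.mul (ContinuousOn.pow
      (ContinuousOn.div (by fun_prop) (by fun_prop) fun x hx => ?_) 3)))
  have := hpos i
  have : (0 : ℝ) ≤ x := hx
  positivity

theorem strictMonoOn_proTSlope (hpos : ∀ i, 0 < s i) (hmax : ∀ i, s i ≤ s ⟨0, hr⟩)
    (hh : 0 ≤ h) : StrictMonoOn (proTSlope r hr s h) (Set.Ici 0) := by
  intro x hx y hy hxy
  have hx : (0 : ℝ) ≤ x := hx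
  have hy : (0 : ℝ) ≤ y := hy
  have h0 := hpos ⟨0, hr⟩
  have hlin : x * (s ⟨0, hr⟩) ^ 2 < y * (s ⟨0, hr⟩) ^ 2 := by gcongr
  rw [proTSlope, proTSlope, sub_eq_add_neg, sub_eq_add_neg]
  refine add_lt_add_of_lt_of_le hlin (neg_le_neg
    (mul_le_mul_of_nonneg_left (Finset.sum_le_sum fun i _ => ?_) hh))
  have hi := hpos i
  have hsq : (s i) ^ 2 ≤ (s ⟨0, hr⟩) ^ 2 := pow_le_pow_left₀ hi.le (hmax i) 2
  gcongr ?_ * ?_ ^ 3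
  rw [div_le_div_iff₀ (by positivity) (by positivity)]
  nlinarith

theorem proTSlope_zero_neg (hpos : ∀ i, 0 < s i) (hh : 0 < h) : proTSlope r hr s h 0 < 0 := by
  have hsum : 0 < ∑ i, (s i) ^ 4 * ((0 + (s ⟨0, hr⟩) ^ 2) / (0 + (s i) ^ 2)) ^ 3 := by
    refine Finset.sum_pos (fun i _ => ?_) ⟨⟨0, hr⟩, Finset.mem_univ _⟩
    have := hpos i
    have := hpos ⟨0, hr⟩
    positivity
  have := mul_pos hh hsum
  rw [proTSlope]
  linarith

theorem proTSlope_half_sq_pos (hpos : ∀ i, 0 < s i) (hh : 0 ≤ h) (hh' : h < 1 / (27 * r)) :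
    0 < proTSlope r hr s h ((s ⟨0, hr⟩) ^ 2 / 2) := by
  have h0 := hpos ⟨0, hr⟩
  have hr0 : (0 : ℝ) < r := Nat.cast_pos.2 hr
  have hterm : ∀ i, (s i) ^ 4 *
      (((s ⟨0, hr⟩) ^ 2 / 2 + (s ⟨0, hr⟩) ^ 2) / ((s ⟨0, hr⟩) ^ 2 / 2 + (s i) ^ 2)) ^ 3
        ≤ (s ⟨0, hr⟩) ^ 4 := by
    intro i
    have hi := hpos i
    have hS : 0 < (s ⟨0, hr⟩) ^ 2 := by positivity
    have hx : 0 < (s i) ^ 2 := by positivity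
    rw [show (s i) ^ 4 = ((s i) ^ 2) ^ 2 by ring,
      show (s ⟨0, hr⟩) ^ 4 = ((s ⟨0, hr⟩) ^ 2) ^ 2 by ring]
    generalize (s ⟨0, hr⟩) ^ 2 = S at *
    generalize (s i) ^ 2 = x at *
    rw [div_pow, ← mul_div_assoc, div_le_iff₀ (by positivity)]
    -- the difference of the two sides is `S² (x - S)² (x + S / 8)`
    have hdiff : 0 ≤ S ^ 2 * ((x - S) ^ 2 * (x + S / 8)) := by positivity
    linarith
  have hsum := Finset.sum_le_card_nsmul Finset.univ _ _ fun i _ => hterm i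
  rw [Finset.card_univ, Fintype.card_fin, nsmul_eq_mul] at hsum
  have hhr : h * (27 * r) < 1 := (lt_div_iff₀ (by positivity)).1 hh'
  have hS4 : 0 < (s ⟨0, hr⟩) ^ 4 := by positivity
  rw [proTSlope]
  nlinarith [mul_le_mul_of_nonneg_left hsum hh, mul_lt_mul_of_pos_right hhr hS4]

end

/-- If `0 < h < 1/(27 r)`, then `T_h` admits a unique global minimizer over
`[0, ∞)`, and this global minimizer lies in `(0, (s 0)²/2]`. -/
theorem proT_unique_global_minimizer (r : ℕ) (hr : 0 < r) (s : Fin r → ℝ)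
    (hpos : ∀ i, 0 < s i) (hmax : ∀ i, s i ≤ s ⟨0, hr⟩)
    (h : ℝ) (hh : 0 < h) (hh' : h < 1 / (27 * r)) :
    ∃ a ∈ Set.Ici (0 : ℝ),
      IsMinOn (proT r hr s h) (Set.Ici 0) a ∧
      a ∈ Set.Ioc (0 : ℝ) ((s ⟨0, hr⟩) ^ 2 / 2) ∧
      ∀ b ∈ Set.Ici (0 : ℝ), IsMinOn (proT r hr s h) (Set.Ici 0) b → b = a := by
  obtain ⟨a, ha, hga⟩ := intermediate_value_Ioo (by positivity)
    ((continuousOn_proTSlope (hr := hr) (h := h) hpos).mono Set.Icc_subset_Ici_self)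
    ⟨proTSlope_zero_neg hpos hh, proTSlope_half_sq_pos hpos hh.le hh'⟩
  have hmono := strictMonoOn_proTSlope hpos hmax hh.le
  have ha0 : a ∈ Set.Ici (0 : ℝ) := ha.1.le
  have hfac : ∀ x : ℝ, 0 ≤ x → 0 < 2 / (x + (s ⟨0, hr⟩) ^ 2) ^ 3 := fun x hx => by
    have := hpos ⟨0, hr⟩
    positivity
  have hcont : ContinuousOn (proT r hr s h) (Set.Ici 0) := fun x hx =>
    (hasDerivAt_proT hpos hx).continuousAt.continuousWithinAt
  have hanti : StrictAntiOn (proT r hr s h) (Set.Icc 0 a) := by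
    refine strictAntiOn_of_deriv_neg (convex_Icc 0 a)
      (hcont.mono Set.Icc_subset_Ici_self) fun x hx => ?_
    rw [interior_Icc] at hx
    rw [(hasDerivAt_proT hpos hx.1.le).deriv]
    exact mul_neg_of_pos_of_neg (hfac x hx.1.le) (hga ▸ hmono hx.1.le ha0 hx.2)
  have hincr : StrictMonoOn (proT r hr s h) (Set.Ici a) := by
    refine strictMonoOn_of_deriv_pos (convex_Ici a)
      (hcont.mono (Set.Ici_subset_Ici.2 ha0)) fun x hx => ?_
    rw [interior_Ici] at hx
    have hx0 : 0 ≤ x := ha.1.le.trans (le_of_lt hx)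
    rw [(hasDerivAt_proT hpos hx0).deriv]
    exact mul_pos (hfac x hx0) (hga ▸ hmono ha0 hx0 hx)
  have hlt : ∀ b ∈ Set.Ici (0 : ℝ), b ≠ a → proT r hr s h a < proT r hr s h b := by
    intro b hb hba
    rcases lt_or_gt_of_ne hba with hlt | hgt
    · exact hanti ⟨hb, hlt.le⟩ ⟨ha0, le_rfl⟩ hlt
    · exact hincr Set.self_mem_Ici hgt.le hgt
  refine ⟨a, ha0, fun b hb => ?_, ⟨ha.1, ha.2.le⟩, fun b hb hmin => ?_⟩
  · rcases eq_or_ne b a with rfl | hba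
    · exact le_refl (proT r hr s h b)
    · exact (hlt b hb hba).le
  · by_contra hba
    exact (hlt b hb hba).not_ge (hmin ha0)
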